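/- Let k, n be positive integers with n < k, and let p₀,…,p_k ∈ ℝ^{1,n} be (k+1) points such that the (n+2) points p₀,…,p_{n+1} are in general position. Then the Lorentzian distance-squared mapping L_{(p₀,…,p_k)} : ℝ^{1,n} → ℝ^{k+1} is A-equivalent to the inclusion (x₀,…,xₙ) ↦ (x₀,…,xₙ, 0,…,0). -/

import Mathlib

open scoped BigOperators

noncomputable section

/-- The Lorentzian inner product on `ℝ^{1,n}`, modeled as `Fin (n+1) → ℝ`:
`⟨x,y⟩ = -x₀y₀ + x₁y₁ + ⋯ + xₙyₙ`. -/
def lorIP {n : ℕ} (x y : Fin (n + 1) → ℝ) : ℝ :=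
  (∑ i, x i * y i) - 2 * (x 0 * y 0)

/-- The Euclidean inner product on `Fin m → ℝ`. -/
def eucIP {m : ℕ} (x y : Fin m → ℝ) : ℝ := ∑ i, x i * y i

/-- The Lorentzian distance-squared mapping determined by the points `p 0, …, p (m-1)`. -/
def LorDSM {n m : ℕ} (p : Fin m → Fin (n + 1) → ℝ) :
    (Fin (n + 1) → ℝ) → (Fin m → ℝ) :=
  fun x i => lorIP (x - p i) (x - p i)

/-- The Euclidean distance-squared mapping determined by the points `p 0, …, p (m-1)`. -/
def EucDSM {n m : ℕ} (p : Fin m → Fin (n + 1) → ℝ) :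
    (Fin (n + 1) → ℝ) → (Fin m → ℝ) :=
  fun x i => eucIP (x - p i) (x - p i)

/-- The recognition subspace `V(p₀, …, p_k)`: the span of the vectors `p i - p 0`. -/
def recSub {n k : ℕ} (p : Fin (k + 1) → Fin (n + 1) → ℝ) :
    Submodule ℝ (Fin (n + 1) → ℝ) :=
  Submodule.span ℝ (Set.range fun i => p i - p 0)

/-- The partial recognition subspace `V(p₀, …, p_j)`: the span of `p i - p 0` for `i ≤ j`. -/
def recSubUpTo {n k : ℕ} (p : Fin (k + 1) → Fin (n + 1) → ℝ) (j : ℕ) :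
    Submodule ℝ (Fin (n + 1) → ℝ) :=
  Submodule.span ℝ {v | ∃ i : Fin (k + 1), (i : ℕ) ≤ j ∧ v = p i - p 0}

/-- A subspace is time-like iff it contains a vector of negative Lorentzian square. -/
def LTimeLike {n : ℕ} (V : Submodule ℝ (Fin (n + 1) → ℝ)) : Prop :=
  ∃ v ∈ V, lorIP v v < 0

/-- A subspace is space-like iff every nonzero vector in it has positive Lorentzian square. -/
def LSpaceLike {n : ℕ} (V : Submodule ℝ (Fin (n + 1) → ℝ)) : Prop :=
  ∀ v ∈ V, v ≠ 0 → 0 < lorIP v v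

/-- A subspace is light-like iff it is neither time-like nor space-like. -/
def LLightLike {n : ℕ} (V : Submodule ℝ (Fin (n + 1) → ℝ)) : Prop :=
  ¬ LTimeLike V ∧ ¬ LSpaceLike V

/-- `f` and `g` are `𝒜`-equivalent: `g = H ∘ f ∘ h` for `C^∞` diffeomorphisms `h, H`. -/
def AEquiv {a b : ℕ} (f g : (Fin a → ℝ) → (Fin b → ℝ)) : Prop :=
  ∃ (h : (Fin a → ℝ) ≃ (Fin a → ℝ)) (H : (Fin b → ℝ) ≃ (Fin b → ℝ)),
    ContDiff ℝ (⊤ : ℕ∞) ⇑h ∧ ContDiff ℝ (⊤ : ℕ∞) ⇑h.symm ∧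
    ContDiff ℝ (⊤ : ℕ∞) ⇑H ∧ ContDiff ℝ (⊤ : ℕ∞) ⇑H.symm ∧
    g = ⇑H ∘ f ∘ ⇑h

/-- Two injective linear maps into a finite-dimensional space differ by an automorphism of it. -/
theorem exists_linearEquiv_comp_eq_of_injective {K E F : Type*} [Field K]
    [AddCommGroup E] [Module K E] [AddCommGroup F] [Module K F] [FiniteDimensional K F]
    (S J : E →ₗ[K] F) (hS : Function.Injective S) (hJ : Function.Injective J) :
    ∃ e : F ≃ₗ[K] F, ∀ x, e (S x) = J x := by
  let r := LinearEquiv.ofInjective S hS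
  obtain ⟨e, he⟩ :=
    Submodule.exists_linearEquiv_restrict_eq (r.symm.trans (LinearEquiv.ofInjective J hJ))
  refine ⟨e, fun x => ?_⟩
  have h := he (r x)
  rw [LinearEquiv.trans_apply, LinearEquiv.symm_apply_apply] at h
  exact h.symm

/-- A smooth map that some linear map inverts from the left, up to a translation, is
`𝒜`-equivalent to every injective linear map. -/
theorem AEquiv.of_linear_leftInverse_add_const {a b : ℕ} {f : (Fin a → ℝ) → (Fin b → ℝ)}
    (hf : ContDiff ℝ (⊤ : ℕ∞) f) (A : (Fin b → ℝ) →ₗ[ℝ] (Fin a → ℝ)) (c : Fin a → ℝ)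
    (hA : ∀ x, A (f x) = x + c) (J : (Fin a → ℝ) →ₗ[ℝ] (Fin b → ℝ))
    (hJ : Function.Injective J) : AEquiv f J := by
  obtain ⟨S, hS⟩ := A.exists_rightInverse_of_surjective
    (LinearMap.range_eq_top.2 fun x => ⟨f (x - c), by rw [hA, sub_add_cancel]⟩)
  have hAS (x) : A (S x) = x := LinearMap.congr_fun hS x
  obtain ⟨e, he⟩ := exists_linearEquiv_comp_eq_of_injective S J
    (Function.LeftInverse.injective hAS) hJ
  have hA' (x) : A (f (x - c)) = x := by rw [hA, sub_add_cancel]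
  -- Shear along the fibres of `A`, carrying the image of `f` to the image of `S`.
  let shear : (Fin b → ℝ) ≃ (Fin b → ℝ) :=
    { toFun := fun y => y - f (A y - c) + S (A y)
      invFun := fun y => y + f (A y - c) - S (A y)
      left_inv := fun y => by
        simp only [map_add, map_sub, hA', hAS, sub_self, zero_add]
        abel
      right_inv := fun y => by
        simp only [map_add, map_sub, hA', hAS, add_sub_cancel_right]
        abel }
  have smooth {m l : ℕ} (T : (Fin m → ℝ) →ₗ[ℝ] (Fin l → ℝ)) : ContDiff ℝ (⊤ : ℕ∞) T :=
    (LinearMap.toContinuousLinearMap T).contDiff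
  have hfA : ContDiff ℝ (⊤ : ℕ∞) fun y => f (A y - c) :=
    hf.comp ((smooth A).sub contDiff_const)
  have hSA : ContDiff ℝ (⊤ : ℕ∞) fun y => S (A y) := (smooth S).comp (smooth A)
  refine ⟨Equiv.subRight c, shear.trans e.toEquiv, contDiff_id.sub contDiff_const,
    contDiff_id.add contDiff_const, (smooth e.toLinearMap).comp ((contDiff_id.sub hfA).add hSA),
    ?_, ?_⟩
  · exact ((contDiff_id.add hfA).sub hSA).comp (smooth e.symm.toLinearMap)
  · funext x
    simp [shear, hA', he]

/-- The Lorentzian inner product is nondegenerate. -/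
theorem eq_zero_of_forall_lorIP_eq_zero {n : ℕ} {x : Fin (n + 1) → ℝ}
    (hx : ∀ v, lorIP x v = 0) : x = 0 := by
  funext i
  have h := hx (Pi.single i 1)
  rcases eq_or_ne i 0 with rfl | hi
  · simp [lorIP, Pi.single_apply] at h
    simp only [Pi.zero_apply]
    linarith
  · simpa [lorIP, Pi.single_apply, hi, hi.symm] using h

/-- The Lorentzian inner product as a bilinear form. -/
def lorForm (n : ℕ) : (Fin (n + 1) → ℝ) →ₗ[ℝ] (Fin (n + 1) → ℝ) →ₗ[ℝ] ℝ :=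
  LinearMap.mk₂ ℝ lorIP
    (fun x y z => by simp only [lorIP, Pi.add_apply, add_mul, Finset.sum_add_distrib]; ring)
    (fun r x y => by
      simp only [lorIP, Pi.smul_apply, smul_eq_mul, mul_assoc, ← Finset.mul_sum]; ring)
    (fun x y z => by simp only [lorIP, Pi.add_apply, mul_add, Finset.sum_add_distrib]; ring)
    (fun r x y => by
      simp only [lorIP, Pi.smul_apply, smul_eq_mul, mul_left_comm _ r, ← Finset.mul_sum]; ring)

theorem lorForm_apply {n : ℕ} (x y : Fin (n + 1) → ℝ) : lorForm n x y = lorIP x y := rfl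

theorem lorIP_comm {n : ℕ} (x y : Fin (n + 1) → ℝ) : lorIP x y = lorIP y x := by
  simp only [lorIP, mul_comm]

theorem contDiff_LorDSM {n m : ℕ} (p : Fin m → Fin (n + 1) → ℝ) :
    ContDiff ℝ (⊤ : ℕ∞) (LorDSM p) := by
  unfold LorDSM lorIP
  simp only [Pi.sub_apply]
  fun_prop

/-- Differences of Lorentzian distance-squared functions are affine. -/
theorem LorDSM_sub_LorDSM {n m : ℕ} (p : Fin m → Fin (n + 1) → ℝ) (x : Fin (n + 1) → ℝ)
    (i j : Fin m) : LorDSM p x i - LorDSM p x j =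
      -2 * lorIP x (p i - p j) + (lorIP (p i) (p i) - lorIP (p j) (p j)) := by
  simp only [LorDSM, ← lorForm_apply, map_sub, LinearMap.sub_apply]
  simp only [lorForm_apply, lorIP_comm _ x]
  ring

/-- If the `p i - p 0` span, some linear map inverts the distance-squared mapping from the left
up to a translation. -/
theorem exists_linear_leftInverse_LorDSM {n k : ℕ} (p : Fin (k + 1) → Fin (n + 1) → ℝ)
    (hp : recSub p = ⊤) :
    ∃ (A : (Fin (k + 1) → ℝ) →ₗ[ℝ] (Fin (n + 1) → ℝ)) (c : Fin (n + 1) → ℝ),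
      ∀ x, A (LorDSM p x) = x + c := by
  let D : (Fin (n + 1) → ℝ) →ₗ[ℝ] (Fin (k + 1) → ℝ) :=
    LinearMap.pi fun i => (-2 : ℝ) • (lorForm n).flip (p i - p 0)
  have hD : LinearMap.ker D = ⊥ := by
    refine LinearMap.ker_eq_bot'.2 fun x hx => eq_zero_of_forall_lorIP_eq_zero fun v => ?_
    have hle : recSub p ≤ LinearMap.ker (lorForm n x) := by
      refine Submodule.span_le.2 ?_
      rintro _ ⟨i, rfl⟩
      simpa [D] using congrFun hx i
    exact hle (hp ▸ Submodule.mem_top : v ∈ recSub p)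
  obtain ⟨G, hG⟩ := D.exists_leftInverse_of_injective hD
  let B : (Fin (k + 1) → ℝ) →ₗ[ℝ] (Fin (k + 1) → ℝ) :=
    LinearMap.pi fun i => LinearMap.proj (R := ℝ) (φ := fun _ => ℝ) i - LinearMap.proj 0
  refine ⟨G ∘ₗ B, G fun i => lorIP (p i) (p i) - lorIP (p 0) (p 0), fun x => ?_⟩
  have hB : B (LorDSM p x) = D x + fun i => lorIP (p i) (p i) - lorIP (p 0) (p 0) := by
    funext i
    exact LorDSM_sub_LorDSM p x i 0
  rw [LinearMap.comp_apply, hB, map_add]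
  congr 1
  exact LinearMap.congr_fun hG x

theorem recSubUpTo_le_recSub {n k : ℕ} (p : Fin (k + 1) → Fin (n + 1) → ℝ) (j : ℕ) :
    recSubUpTo p j ≤ recSub p := by
  refine Submodule.span_mono ?_
  rintro _ ⟨i, -, rfl⟩
  exact ⟨i, rfl⟩

theorem theorem1_3 (k n : ℕ) (hn : 1 ≤ n) (hnk : n < k)
    (p : Fin (k + 1) → Fin (n + 1) → ℝ)
    (hgen : Module.finrank ℝ (recSubUpTo p (n + 1)) = n + 1) :
    AEquiv (LorDSM p)
        (fun (x : Fin (n + 1) → ℝ) (i : Fin (k + 1)) =>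
          if h : (i : ℕ) < n + 1 then x ⟨(i : ℕ), h⟩ else 0) := by
  have hp : recSub p = ⊤ := by
    refine top_le_iff.1 ((recSubUpTo_le_recSub p (n + 1)).trans' (top_le_iff.2 ?_))
    exact Submodule.eq_top_of_finrank_eq (by rw [hgen, Module.finrank_fin_fun])
  obtain ⟨A, c, hA⟩ := exists_linear_leftInverse_LorDSM p hp
  let J : (Fin (n + 1) → ℝ) →ₗ[ℝ] (Fin (k + 1) → ℝ) :=
    { toFun := fun x i => if h : (i : ℕ) < n + 1 then x ⟨(i : ℕ), h⟩ else 0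
      map_add' := fun x y => by
        funext i
        by_cases h : (i : ℕ) < n + 1 <;> simp [h, -Order.lt_add_one_iff]
      map_smul' := fun r x => by
        funext i
        by_cases h : (i : ℕ) < n + 1 <;> simp [h, -Order.lt_add_one_iff] }
  refine AEquiv.of_linear_leftInverse_add_const (contDiff_LorDSM p) A c hA J fun x y hxy => ?_
  funext i
  simpa [J, -Order.lt_add_one_iff] using congrFun hxy ⟨i, by omega⟩
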